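/- If φ is the Laplace transform of a probability distribution on [0,∞) and there exists, for every 0 < c < 1, a Laplace transform φ_c of a probability distribution on [0,∞) such that φ(s) = φ(cs)·φ_c(s) for all s > 0 (i.e. the distribution with LT φ is self-decomposable), then for any strictly stable characteristic exponent ψ (so exp(-ψ) is a strictly stable CF), the function t ↦ φ(ψ(t)) also satisfies φ(ψ(t)) = φ(ψ(ct'))·φ_c(ψ(t)) with ψ(ct') = c^α-scaled version, i.e. the φ-mixture of the strictly stable law is self-decomposable (class L). -/

import Mathlib

open MeasureTheory

/-- `f` is a characteristic function of a probability distribution on `ℝ`. -/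
def IsCF (f : ℝ → ℂ) : Prop :=
  ∃ μ : Measure ℝ, IsProbabilityMeasure μ ∧
    ∀ t, f t = ∫ x, Complex.exp ((t:ℂ) * (x:ℂ) * Complex.I) ∂μ

/-- `φ` is the Laplace transform of a probability distribution on `[0,∞)`
(extended to complex arguments with nonnegative real part). -/
def IsLT (φ : ℂ → ℂ) : Prop :=
  ∃ μ : Measure ℝ, IsProbabilityMeasure μ ∧ μ (Set.Iio (0:ℝ)) = 0 ∧
    ∀ z : ℂ, 0 ≤ z.re → φ z = ∫ s, Complex.exp (-z * (s:ℂ)) ∂μ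

open Filter Topology

theorem isCF_iff_charFun {f : ℝ → ℂ} :
    IsCF f ↔ ∃ μ : Measure ℝ, IsProbabilityMeasure μ ∧ ∀ t, f t = charFun μ t := by
  simp only [IsCF, charFun_apply_real]

theorem isCF_charFun (μ : Measure ℝ) [IsProbabilityMeasure μ] : IsCF (charFun μ) :=
  isCF_iff_charFun.2 ⟨μ, inferInstance, fun _ => rfl⟩

namespace IsCF

theorem congr {f g : ℝ → ℂ} (hf : IsCF f) (h : ∀ t, f t = g t) : IsCF g :=
  funext h ▸ hf

theorem mul {f g : ℝ → ℂ} (hf : IsCF f) (hg : IsCF g) : IsCF fun t => f t * g t := by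
  obtain ⟨μ, _, hμ⟩ := isCF_iff_charFun.1 hf
  obtain ⟨ν, _, hν⟩ := isCF_iff_charFun.1 hg
  exact (isCF_charFun (μ ∗ ν)).congr fun t => by rw [charFun_conv, hμ, hν]

theorem exp_mul_I (a : ℝ) : IsCF fun t => Complex.exp (a * t * Complex.I) :=
  (isCF_charFun (Measure.dirac a)).congr fun t => by
    rw [charFun_dirac]
    simp [mul_comm]

theorem pow {f : ℝ → ℂ} (hf : IsCF f) (n : ℕ) : IsCF fun t => f t ^ n := by
  induction n with
  | zero => simpa using exp_mul_I 0
  | succ n ih => simpa only [pow_succ] using ih.mul hf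

theorem comp_mul {f : ℝ → ℂ} (hf : IsCF f) (a : ℝ) : IsCF fun t => f (a * t) := by
  obtain ⟨μ, _, hμ⟩ := isCF_iff_charFun.1 hf
  have : IsProbabilityMeasure (μ.map (a * ·)) :=
    Measure.isProbabilityMeasure_map (by fun_prop)
  exact (isCF_charFun (μ.map (a * ·))).congr fun t => by rw [charFun_map_mul, hμ]

/-- **Lévy's continuity theorem**: a pointwise limit of characteristic functions which is
continuous at `0` is a characteristic function. -/
theorem of_tendsto {F : ℕ → ℝ → ℂ} {f : ℝ → ℂ} (hF : ∀ n, IsCF (F n))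
    (hf : ContinuousAt f 0) (h : ∀ t, Tendsto (fun n => F n t) atTop (𝓝 (f t))) : IsCF f := by
  choose μ hμ hFμ using fun n => isCF_iff_charFun.1 (hF n)
  simp only [hFμ] at h
  let P : ℕ → ProbabilityMeasure ℝ := fun n => ⟨μ n, hμ n⟩
  have tight : IsTightMeasureSet (Set.range μ) := isTightMeasureSet_of_tendsto_charFun hf h
  have compact : IsCompact (closure (Set.range P)) := by
    apply isCompact_closure_of_isTightMeasureSet
    convert! tight using 1
    ext ν
    exact Set.exists_range_iff
  let U : Ultrafilter ℕ := hyperfilter ℕ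
  have hU : (U : Filter ℕ) ≤ atTop := Nat.hyperfilter_le_atTop
  obtain ⟨ν, -, hν⟩ := compact.ultrafilter_le_nhds (U.map P)
    (.trans (by simp) (monotone_principal subset_closure))
  have hν' : Tendsto P U (𝓝 ν) := hν
  refine (isCF_charFun (ν : Measure ℝ)).congr fun t => ?_
  refine tendsto_nhds_unique ?_ ((h t).mono_left hU)
  rw [ProbabilityMeasure.tendsto_iff_forall_integral_rclike_tendsto ℂ] at hν'
  simp_rw [charFun_eq_integral_innerProbChar]
  exact hν' _

/-- The probability generating function of a distribution on `ℕ`, evaluated at `exp (t * I)`. -/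
theorem of_hasSum_one {p : ℕ → ℝ} (hp : ∀ k, 0 ≤ p k) (hs : HasSum p 1) :
    IsCF fun t => ∑' k, (p k : ℂ) * Complex.exp (t * Complex.I) ^ k := by
  let μ : Measure ℝ := Measure.sum fun k => ENNReal.ofReal (p k) • Measure.dirac (k : ℝ)
  have : IsProbabilityMeasure μ := ⟨by
    simp [μ, ← ENNReal.ofReal_tsum_of_nonneg hp hs.summable, hs.tsum_eq]⟩
  refine (isCF_charFun μ).congr fun t => ?_
  rw [charFun_apply_real, integral_sum_dirac (by simp)]
  refine tsum_congr fun k => ?_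
  rw [ENNReal.toReal_ofReal (hp k), Complex.real_smul, ← Complex.exp_nat_mul]
  push_cast
  ring_nf

/-- A power series with nonnegative coefficients which extends continuously to the closed unit
disc and equals `1` at `1` is a characteristic function along the unit circle. -/
theorem of_hasSum_powerSeries {a : ℕ → ℝ} (ha : ∀ k, 0 ≤ a k) {h : ℂ → ℂ}
    (hs : ∀ z : ℂ, ‖z‖ < 1 → HasSum (fun k => (a k : ℂ) * z ^ k) (h z))
    (hc : ∀ z : ℂ, ‖z‖ ≤ 1 → ContinuousAt h z) (h1 : h 1 = 1) :
    IsCF fun t => h (Complex.exp (t * Complex.I)) := by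
  have hr : ∃ r : ℕ → ℝ, (∀ n, 0 ≤ r n ∧ r n < 1) ∧ Tendsto r atTop (𝓝 1) := by
    refine ⟨fun n => n / (n + 1), fun n => ⟨by positivity, ?_⟩, tendsto_natCast_div_add_atTop 1⟩
    rw [div_lt_one (by positivity)]
    linarith
  obtain ⟨r, hr01, hr⟩ := hr
  have hr' : Tendsto (fun n => (r n : ℂ)) atTop (𝓝 1) := by
    exact_mod_cast (Complex.continuous_ofReal.tendsto 1).comp hr
  have lim (z : ℂ) (hz : ‖z‖ = 1) : Tendsto (fun n => h (r n * z)) atTop (𝓝 (h z)) :=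
    (hc z hz.le).tendsto.comp (by simpa using hr'.mul_const z)
  have norm_r (n : ℕ) : ‖(r n : ℂ)‖ < 1 := by
    rw [Complex.norm_of_nonneg (hr01 n).1]
    exact (hr01 n).2
  have real_sum (n : ℕ) : HasSum (fun k => a k * r n ^ k) (h (r n)).re := by
    simpa [← Complex.ofReal_pow] using Complex.hasSum_re (hs (r n) (norm_r n))
  have real_val (n : ℕ) : ((h (r n)).re : ℂ) = h (r n) := by
    refine HasSum.unique ?_ (hs (r n) (norm_r n))
    simpa using Complex.hasSum_ofReal.2 (real_sum n)
  have lim1 : Tendsto (fun n => h (r n)) atTop (𝓝 1) := by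
    simpa [h1] using lim 1 (by simp)
  have nonzero : ∀ᶠ n in atTop, h (r n) ≠ 0 := lim1.eventually_ne one_ne_zero
  obtain ⟨N, hN⟩ := eventually_atTop.1 nonzero
  refine of_tendsto (F := fun n t =>
    h (r (n + N) * Complex.exp (t * Complex.I)) / h (r (n + N))) (fun n => ?_) ?_ fun t => ?_
  · have hne : (h (r (n + N))).re ≠ 0 := fun h0 => hN (n + N) (by omega) (by
      rw [← real_val, h0, Complex.ofReal_zero])
    have hnn : 0 ≤ (h (r (n + N))).re :=
      (real_sum (n + N)).nonneg fun k => mul_nonneg (ha k) (pow_nonneg (hr01 _).1 k)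
    refine (of_hasSum_one (p := fun k => a k * r (n + N) ^ k / (h (r (n + N))).re) (fun k =>
      div_nonneg (mul_nonneg (ha k) (pow_nonneg (hr01 _).1 k)) hnn) ?_).congr fun t => ?_
    · simpa [hne] using (real_sum (n + N)).div_const (h (r (n + N))).re
    · have := (hs ((r (n + N)) * Complex.exp (t * Complex.I)) (by
        rw [norm_mul, Complex.norm_exp_ofReal_mul_I, mul_one]; exact norm_r _)).div_const (h (r (n + N)))
      rw [← this.tsum_eq]
      refine tsum_congr fun k => ?_
      push_cast
      rw [real_val]
      ring
  · refine ContinuousAt.comp (hc _ (by simp)) ?_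
    fun_prop
  · have := (lim _ (Complex.norm_exp_ofReal_mul_I t)).div lim1 one_ne_zero
    simpa using (tendsto_add_atTop_iff_nat N).2 this

end IsCF

theorem succ_mul_choose_succ (α : ℝ) (k : ℕ) :
    (k + 1) * Ring.choose α (k + 1) = (α - k) * Ring.choose α k := by
  have hk : (k.factorial : ℝ) ≠ 0 := by positivity
  rw [Ring.choose_eq_smul, Ring.choose_eq_smul, descPochhammer_succ_right,
    Polynomial.smeval_mul, Nat.factorial_succ]
  simp only [Polynomial.smeval_sub, Polynomial.smeval_X, pow_one, Polynomial.smeval_natCast,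
    pow_zero, smul_eq_mul, nsmul_eq_mul, mul_one]
  push_cast
  field_simp

theorem neg_one_pow_mul_choose_succ (α : ℝ) (k : ℕ) :
    (-1) ^ (k + 1) * Ring.choose α (k + 1) =
      (k - α) / (k + 1) * ((-1) ^ k * Ring.choose α k) := by
  have := succ_mul_choose_succ α k
  field_simp
  rw [pow_succ]
  linear_combination (-1) ^ k * (-1) * this

theorem neg_one_pow_mul_choose_nonpos {α : ℝ} (h0 : 0 ≤ α) (h1 : α ≤ 1) (k : ℕ) :
    (-1) ^ (k + 1) * Ring.choose α (k + 1) ≤ 0 := by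
  induction k with
  | zero => simpa using h0
  | succ k ih =>
    rw [neg_one_pow_mul_choose_succ]
    refine mul_nonpos_of_nonneg_of_nonpos (div_nonneg ?_ (by positivity)) ih
    push_cast
    linarith [k.cast_nonneg (α := ℝ)]

theorem neg_one_pow_mul_choose_nonneg {α : ℝ} (h1 : 1 ≤ α) (h2 : α ≤ 2) (k : ℕ) :
    0 ≤ (-1) ^ (k + 2) * Ring.choose α (k + 2) := by
  induction k with
  | zero =>
    rw [neg_one_pow_mul_choose_succ, neg_one_pow_mul_choose_succ]
    norm_num
    nlinarith
  | succ k ih =>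
    rw [neg_one_pow_mul_choose_succ]
    refine mul_nonneg (div_nonneg ?_ (by positivity)) ih
    push_cast
    linarith [k.cast_nonneg (α := ℝ)]

theorem hasSum_one_sub_cpow (α : ℝ) {z : ℂ} (hz : ‖z‖ < 1) :
    HasSum (fun k : ℕ => (((-1) ^ k * Ring.choose α k : ℝ) : ℂ) * z ^ k)
      ((1 - z) ^ (α : ℂ)) := by
  have := (Complex.one_add_cpow_hasFPowerSeriesOnBall_zero (a := (α : ℂ))).hasSum (y := -z)
    (by simpa [← ENNReal.ofReal_one, Metric.eball_ofReal] using hz)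
  convert! this using 1
  · ext k
    have hmap : ((Ring.choose α k : ℝ) : ℂ) = Ring.choose (α : ℂ) k :=
      Ring.map_choose Complex.ofRealHom α k
    rw [binomialSeries_apply, ← hmap, List.ofFn_const, List.prod_replicate, neg_pow z]
    push_cast
    simp only [smul_eq_mul]
    ring
  · simp [sub_eq_add_neg]

theorem continuousAt_one_sub_cpow {α : ℝ} (hα : 0 < α) {z : ℂ} (hz : ‖z‖ ≤ 1) :
    ContinuousAt (fun z : ℂ => (1 - z) ^ (α : ℂ)) z := by
  refine (Complex.continuousAt_cpow_const_of_re_pos (z := 1 - z) (.inl ?_) (by simpa)).comp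
    (f := fun z : ℂ => 1 - z) (by fun_prop)
  simpa using (Complex.re_le_norm z).trans hz

/-- The characteristic function of the Sibuya distribution. -/
theorem isCF_one_sub_one_sub_cpow {α : ℝ} (h0 : 0 < α) (h1 : α ≤ 1) :
    IsCF fun t => 1 - (1 - Complex.exp (t * Complex.I)) ^ (α : ℂ) := by
  refine IsCF.of_hasSum_powerSeries (h := fun z => 1 - (1 - z) ^ (α : ℂ))
    (a := fun k => (if k = 0 then 1 else 0) - (-1) ^ k * Ring.choose α k)
    (fun k => ?_) (fun z hz => ?_) (fun z hz => ?_) ?_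
  · cases k with
    | zero => simp
    | succ k => simpa using neg_one_pow_mul_choose_nonpos h0.le h1 k
  · refine ((hasSum_ite_eq 0 (1 : ℂ)).sub (hasSum_one_sub_cpow α hz)).congr_fun fun k => ?_
    cases k <;> simp
  · exact continuousAt_const.sub (continuousAt_one_sub_cpow h0 hz)
  · simp [h0.ne']

theorem isCF_one_add_one_sub_cpow {α : ℝ} (h1 : 1 ≤ α) (h2 : α ≤ 2) :
    IsCF fun t => 1 + (α : ℂ)⁻¹ * Complex.exp (-t * Complex.I) *
      (1 - Complex.exp (t * Complex.I)) ^ (α : ℂ) := by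
  have h0 : 0 < α := by linarith
  have key : IsCF fun t => Complex.exp (t * Complex.I) +
      (α : ℂ)⁻¹ * (1 - Complex.exp (t * Complex.I)) ^ (α : ℂ) := by
    refine IsCF.of_hasSum_powerSeries (h := fun z => z + (α : ℂ)⁻¹ * (1 - z) ^ (α : ℂ))
      (a := fun k => (if k = 1 then 1 else 0) + α⁻¹ * ((-1) ^ k * Ring.choose α k))
      (fun k => ?_) (fun z hz => ?_) (fun z hz => ?_) ?_
    · match k with
      | 0 => simpa using h0.le
      | 1 => simp [h0.ne']
      | k + 2 => simpa using mul_nonneg (inv_nonneg.2 h0.le) (neg_one_pow_mul_choose_nonneg h1 h2 k)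
    · refine ((hasSum_ite_eq 1 z).add
        ((hasSum_one_sub_cpow α hz).mul_left (α : ℂ)⁻¹)).congr_fun fun k => ?_
      by_cases hk : k = 1
      · simp [hk, add_mul, mul_assoc]
      · simp [hk, mul_assoc]
    · exact continuousAt_id.add (continuousAt_const.mul (continuousAt_one_sub_cpow h0 hz))
    · simp [h0.ne']
  refine (key.mul (IsCF.exp_mul_I (-1))).congr fun t => ?_
  have : Complex.exp (t * Complex.I) * Complex.exp (-t * Complex.I) = 1 := by
    rw [← Complex.exp_add]
    simp
  push_cast
  simp only [neg_one_mul]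
  linear_combination this

theorem ofReal_mul_cpow {x : ℝ} (hx : 0 < x) (z : ℂ) {α : ℝ} (hα : 0 < α) :
    ((x : ℂ) * z) ^ (α : ℂ) = ((x ^ α : ℝ) : ℂ) * z ^ (α : ℂ) := by
  have hα' : (α : ℂ) ≠ 0 := by exact_mod_cast hα.ne'
  rcases eq_or_ne z 0 with rfl | hz
  · simp [hα.ne']
  have hx' : (x : ℂ) ≠ 0 := by exact_mod_cast hx.ne'
  rw [Complex.ofReal_cpow hx.le, Complex.cpow_def_of_ne_zero (mul_ne_zero hx' hz),
    Complex.cpow_def_of_ne_zero hx', Complex.cpow_def_of_ne_zero hz, ← Complex.exp_add,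
    Complex.log_ofReal_mul hx hz, Complex.ofReal_log hx.le, add_mul]

theorem continuous_neg_ofReal_mul_I_cpow {α : ℝ} (hα : 0 < α) :
    Continuous fun t : ℝ => (-(t * Complex.I)) ^ (α : ℂ) :=
  continuous_iff_continuousAt.2 fun t =>
    (Complex.continuousAt_cpow_const_of_re_pos (z := -(t * Complex.I)) (.inl (by simp))
      (by simpa)).comp (f := fun t : ℝ => -(t * Complex.I)) (by fun_prop)

/-- A distribution whose characteristic function behaves like `1 + C * (-i t) ^ α` at the origin
is in the domain of attraction of a one-sided stable law. -/
theorem IsCF.exp_mul_cpow {α : ℝ} (hα : 0 < α) (C : ℂ) {w : ℝ → ℂ} (hw : ContinuousAt w 0)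
    (hw0 : w 0 = 1)
    (hf : IsCF fun t => 1 + C * w t * (1 - Complex.exp (t * Complex.I)) ^ (α : ℂ)) :
    IsCF fun t => Complex.exp (C * (-(t * Complex.I)) ^ (α : ℂ)) := by
  have lim : Tendsto (fun n : ℕ => (n : ℝ) ^ (-α⁻¹)) atTop (𝓝[>] 0) := by
    refine tendsto_nhdsWithin_iff.2
      ⟨(tendsto_rpow_neg_atTop (inv_pos.2 hα)).comp tendsto_natCast_atTop_atTop, ?_⟩
    filter_upwards [eventually_gt_atTop 0] with n hn
    exact Real.rpow_pos_of_pos (by exact_mod_cast hn) _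
  refine IsCF.of_tendsto (fun n => (hf.comp_mul ((n : ℝ) ^ (-α⁻¹))).pow n)
    (((continuous_neg_ofReal_mul_I_cpow hα).const_mul C).cexp.continuousAt) fun t => ?_
  apply Complex.tendsto_one_add_pow_exp_of_tendsto
  have slope : Tendsto (fun n : ℕ => (((n : ℝ) ^ α⁻¹ : ℝ) : ℂ) *
      (1 - Complex.exp (((n : ℝ) ^ (-α⁻¹) * t : ℝ) * Complex.I))) atTop
      (𝓝 (-(t * Complex.I))) := by
    have hd : HasDerivAt (fun s : ℝ => Complex.exp ((s * t : ℝ) * Complex.I))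
        (t * Complex.I) 0 := by
      have h := (((hasDerivAt_id (0 : ℝ)).mul_const t).ofReal_comp.mul_const Complex.I).cexp
      simpa using h
    refine (hd.tendsto_slope_zero_right.comp lim).neg.congr fun n => ?_
    simp only [Function.comp_apply, zero_add, zero_mul, Complex.ofReal_zero, Complex.exp_zero,
      Complex.real_smul, Real.rpow_neg n.cast_nonneg, inv_inv]
    ring
  have hcpow := (Complex.continuousAt_cpow_const_of_re_pos (z := -(t * Complex.I)) (w := α)
    (.inl (by simp)) (by simpa)).tendsto.comp slope
  have hwlim : Tendsto (fun n : ℕ => w ((n : ℝ) ^ (-α⁻¹) * t)) atTop (𝓝 1) := by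
    rw [← hw0]
    refine hw.tendsto.comp ?_
    simpa using (tendsto_nhdsWithin_iff.1 lim).1.mul_const t
  have := (hwlim.const_mul C).mul hcpow
  rw [mul_one] at this
  refine this.congr' ?_
  filter_upwards [eventually_gt_atTop 0] with n hn
  have hn' : (0 : ℝ) < n := by exact_mod_cast hn
  rw [Function.comp_apply, ofReal_mul_cpow (Real.rpow_pos_of_pos hn' _) _ hα, ← Real.rpow_mul hn'.le,
    inv_mul_cancel₀ hα.ne', Real.rpow_one]
  push_cast
  ring

theorem isCF_exp_neg_cpow {α : ℝ} (h0 : 0 < α) (h1 : α ≤ 1) :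
    IsCF fun t => Complex.exp (-(-(t * Complex.I)) ^ (α : ℂ)) := by
  refine (IsCF.exp_mul_cpow h0 (-1) (w := fun _ => 1) continuousAt_const rfl ?_).congr
    fun t => by rw [neg_one_mul]
  exact (isCF_one_sub_one_sub_cpow h0 h1).congr fun t => by ring

theorem isCF_exp_cpow {α : ℝ} (h1 : 1 ≤ α) (h2 : α ≤ 2) :
    IsCF fun t => Complex.exp ((α : ℂ)⁻¹ * (-(t * Complex.I)) ^ (α : ℂ)) :=
  IsCF.exp_mul_cpow (by linarith) _ (w := fun t => Complex.exp (-t * Complex.I)) (by fun_prop)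
    (by simp) (isCF_one_add_one_sub_cpow h1 h2)

/-- The exponent `l |t|^α exp (-i θ sgn t)` of a strictly stable law. -/
noncomputable def stableExponent (l α θ t : ℝ) : ℂ :=
  ((l * |t| ^ α : ℝ) : ℂ) * Complex.exp (-((θ * Real.sign t : ℝ) : ℂ) * Complex.I)

section stableExponent

variable {l α θ : ℝ}

theorem stableExponent_zero (hα : α ≠ 0) : stableExponent l α θ 0 = 0 := by
  simp [stableExponent, hα]

theorem stableExponent_of_pos {t : ℝ} (ht : 0 < t) :
    stableExponent l α θ t = ((l * t ^ α : ℝ) : ℂ) * Complex.exp (-θ * Complex.I) := by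
  simp [stableExponent, Real.sign_of_pos ht, abs_of_pos ht]

theorem stableExponent_of_neg {t : ℝ} (ht : t < 0) :
    stableExponent l α θ t = ((l * (-t) ^ α : ℝ) : ℂ) * Complex.exp (θ * Complex.I) := by
  simp [stableExponent, Real.sign_of_neg ht, abs_of_neg ht]

theorem stableExponent_neg (t : ℝ) : stableExponent l α θ (-t) = stableExponent l α (-θ) t := by
  simp [stableExponent, Real.sign_neg]

theorem stableExponent_mul (hα : α ≠ 0) {a : ℝ} (ha : 0 ≤ a) (t : ℝ) :
    stableExponent l α θ (a * t) = ((a ^ α : ℝ) : ℂ) * stableExponent l α θ t := by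
  rcases ha.eq_or_lt with rfl | ha'
  · simp [stableExponent, hα]
  have hsign : Real.sign (a * t) = Real.sign t := by
    rcases lt_trichotomy t 0 with ht | rfl | ht
    · rw [Real.sign_of_neg ht, Real.sign_of_neg (mul_neg_of_pos_of_neg ha' ht)]
    · rw [mul_zero]
    · rw [Real.sign_of_pos ht, Real.sign_of_pos (mul_pos ha' ht)]
  rw [stableExponent, stableExponent, hsign, abs_mul, abs_of_pos ha',
    Real.mul_rpow ha (abs_nonneg t)]
  push_cast
  ring

theorem stableExponent_eq_ofReal_mul (a : ℝ) (t : ℝ) :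
    stableExponent (a * l) α θ t = a * stableExponent l α θ t := by
  simp only [stableExponent]
  push_cast
  ring

theorem norm_stableExponent (hl : 0 ≤ l) (t : ℝ) : ‖stableExponent l α θ t‖ = l * |t| ^ α := by
  rw [stableExponent, norm_mul, ← Complex.ofReal_neg, Complex.norm_exp_ofReal_mul_I, mul_one,
    Complex.norm_of_nonneg (by positivity)]

theorem continuousAt_stableExponent_zero (hl : 0 ≤ l) (hα : 0 < α) :
    ContinuousAt (stableExponent l α θ) 0 := by
  rw [ContinuousAt, stableExponent_zero hα.ne', tendsto_zero_iff_norm_tendsto_zero]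
  simp only [norm_stableExponent hl]
  have : Continuous fun t : ℝ => l * |t| ^ α :=
    continuous_const.mul (continuous_abs.rpow_const fun _ => .inr hα.le)
  simpa [hα.ne'] using this.tendsto 0

theorem stableExponent_re_nonneg (hl : 0 ≤ l) (hθ : |θ| ≤ Real.pi / 2) (t : ℝ) :
    0 ≤ (stableExponent l α θ t).re := by
  rw [stableExponent, Complex.re_ofReal_mul, ← Complex.ofReal_neg, Complex.exp_ofReal_mul_I_re,
    Real.cos_neg]
  refine mul_nonneg (by positivity) (Real.cos_nonneg_of_mem_Icc (abs_le.1 ?_))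
  rw [abs_mul]
  refine (mul_le_of_le_one_right (abs_nonneg θ) ?_).trans hθ
  rcases Real.sign_apply_eq t with h | h | h <;> simp [h]

theorem neg_ofReal_mul_I_cpow (hα : 0 < α) (t : ℝ) :
    (-(t * Complex.I)) ^ (α : ℂ) = stableExponent 1 α (Real.pi * α / 2) t := by
  rcases lt_trichotomy t 0 with ht | rfl | ht
  · rw [stableExponent_of_neg ht, one_mul,
      show -(t * Complex.I) = ((-t : ℝ) : ℂ) * Complex.I by push_cast; ring,
      ofReal_mul_cpow (neg_pos.2 ht) _ hα, Complex.cpow_def_of_ne_zero Complex.I_ne_zero,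
      Complex.log_I]
    push_cast
    ring_nf
  · simp [stableExponent_zero hα.ne', hα.ne']
  · rw [stableExponent_of_pos ht, one_mul,
      show -(t * Complex.I) = (t : ℂ) * (-Complex.I) by ring,
      ofReal_mul_cpow ht _ hα, Complex.cpow_def_of_ne_zero (neg_ne_zero.2 Complex.I_ne_zero),
      Complex.log_neg_I]
    push_cast
    ring_nf

theorem neg_stableExponent (hα : α ≠ 0) (t : ℝ) :
    -stableExponent l α θ t = stableExponent l α (θ - Real.pi) t := by
  rcases lt_trichotomy t 0 with ht | rfl | ht
  · rw [stableExponent_of_neg ht, stableExponent_of_neg ht, Complex.ofReal_sub, sub_mul,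
      Complex.exp_sub_pi_mul_I, mul_neg]
  · simp [stableExponent_zero hα]
  · rw [stableExponent_of_pos ht, stableExponent_of_pos ht, Complex.ofReal_sub, neg_sub,
      sub_eq_neg_add, add_mul, Complex.exp_add_pi_mul_I, mul_neg]

/-- Decomposition of a stable exponent into the two extremal ones with angles `±β`. -/
theorem sin_two_mul_mul_stableExponent (hα : α ≠ 0) (β t : ℝ) :
    Real.sin (2 * β) * stableExponent l α θ t =
      Real.sin (β + θ) * stableExponent l α β t +
        Real.sin (β - θ) * stableExponent l α (-β) t := by
  have key (θ : ℂ) (β : ℂ) : Complex.sin (2 * β) * Complex.exp (θ * Complex.I) =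
      Complex.sin (β - θ) * Complex.exp (-β * Complex.I) +
        Complex.sin (β + θ) * Complex.exp (β * Complex.I) := by
    simp only [Complex.exp_mul_I, Complex.sin_two_mul, Complex.sin_add, Complex.sin_sub,
      Complex.cos_neg, Complex.sin_neg]
    ring
  rcases lt_trichotomy t 0 with ht | rfl | ht
  · simp only [stableExponent_of_neg ht]
    have := key θ β
    push_cast
    linear_combination ((l : ℂ) * ((-t) ^ α : ℝ)) * this
  · simp [stableExponent_zero hα]
  · simp only [stableExponent_of_pos ht]
    have := key (-θ) β
    rw [sub_neg_eq_add, ← sub_eq_add_neg] at this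
    push_cast
    rw [neg_neg]
    linear_combination ((l : ℂ) * (t ^ α : ℝ)) * this

theorem IsCF.exp_neg_stableExponent_scale (hα : 0 < α)
    (h : IsCF fun t => Complex.exp (-stableExponent l α θ t)) {a : ℝ} (ha : 0 ≤ a) :
    IsCF fun t => Complex.exp (-stableExponent (a * l) α θ t) :=
  (h.comp_mul (a ^ α⁻¹)).congr fun t => by
    rw [stableExponent_mul hα.ne' (by positivity), ← Real.rpow_mul ha, inv_mul_cancel₀ hα.ne',
      Real.rpow_one, stableExponent_eq_ofReal_mul]

theorem IsCF.exp_neg_stableExponent_of_abs_le {β : ℝ} (hα : 0 < α) (hβ0 : 0 < β)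
    (hβ : β < Real.pi / 2) (h : IsCF fun t => Complex.exp (-stableExponent l α β t))
    (hθ : |θ| ≤ β) : IsCF fun t => Complex.exp (-stableExponent l α θ t) := by
  obtain ⟨hθ1, hθ2⟩ := abs_le.1 hθ
  have hsin : 0 < Real.sin (2 * β) := Real.sin_pos_of_pos_of_lt_pi (by linarith) (by linarith)
  have h' : IsCF fun t => Complex.exp (-stableExponent l α (-β) t) :=
    (h.comp_mul (-1)).congr fun t => by rw [neg_one_mul, stableExponent_neg]
  have ha : 0 ≤ Real.sin (β + θ) / Real.sin (2 * β) :=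
    div_nonneg (Real.sin_nonneg_of_nonneg_of_le_pi (by linarith) (by linarith)) hsin.le
  have hb : 0 ≤ Real.sin (β - θ) / Real.sin (2 * β) :=
    div_nonneg (Real.sin_nonneg_of_nonneg_of_le_pi (by linarith) (by linarith)) hsin.le
  refine ((h.exp_neg_stableExponent_scale hα ha).mul
    (h'.exp_neg_stableExponent_scale hα hb)).congr fun t => ?_
  have hsin' : (Real.sin (2 * β) : ℂ) ≠ 0 := by exact_mod_cast hsin.ne'
  rw [← Complex.exp_add, stableExponent_eq_ofReal_mul, stableExponent_eq_ofReal_mul]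
  congr 1
  rw [Complex.ofReal_div, Complex.ofReal_div]
  have := sin_two_mul_mul_stableExponent (l := l) (θ := θ) hα.ne' β t
  generalize (Real.sin (2 * β) : ℂ) = S at this hsin' ⊢
  field_simp
  linear_combination this

theorem IsCF.exp_neg_stableExponent_of_tendsto {a ϑ : ℕ → ℝ} (hl : 0 ≤ l) (hα : 0 < α)
    (h : ∀ n, IsCF fun t => Complex.exp (-stableExponent l (a n) (ϑ n) t))
    (ha : Tendsto a atTop (𝓝 α)) (hϑ : Tendsto ϑ atTop (𝓝 θ)) :
    IsCF fun t => Complex.exp (-stableExponent l α θ t) := by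
  refine IsCF.of_tendsto h (continuousAt_stableExponent_zero hl hα).neg.cexp fun t => ?_
  refine Tendsto.cexp (Tendsto.neg (Tendsto.mul ?_ (Tendsto.cexp (Tendsto.mul_const _ ?_))))
  · exact (Complex.continuous_ofReal.tendsto _).comp
      ((tendsto_const_nhds.rpow ha (.inr hα)).const_mul l)
  · exact ((Complex.continuous_ofReal.tendsto _).comp (hϑ.mul_const _)).neg

theorem isCF_exp_neg_stableExponent_of_lt_one (hl : 0 ≤ l) (h0 : 0 < α) (h1 : α < 1)
    (hθ : |θ| ≤ Real.pi * α / 2) : IsCF fun t => Complex.exp (-stableExponent l α θ t) := by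
  have hpi := Real.pi_pos
  have base : IsCF fun t => Complex.exp (-stableExponent 1 α (Real.pi * α / 2) t) :=
    (isCF_exp_neg_cpow h0 h1.le).congr fun t => by rw [neg_ofReal_mul_I_cpow h0]
  simpa using (base.exp_neg_stableExponent_of_abs_le h0 (by positivity) (by nlinarith)
    hθ).exp_neg_stableExponent_scale h0 hl

theorem isCF_exp_neg_stableExponent_of_one_lt (hl : 0 ≤ l) (h1 : 1 < α) (h2 : α < 2)
    (hθ : |θ| ≤ Real.pi - Real.pi * α / 2) :
    IsCF fun t => Complex.exp (-stableExponent l α θ t) := by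
  have hpi := Real.pi_pos
  have h0 : 0 < α := by linarith
  have base : IsCF fun t =>
      Complex.exp (-stableExponent α⁻¹ α (Real.pi - Real.pi * α / 2) t) := by
    refine ((isCF_exp_cpow h1.le h2.le).comp_mul (-1)).congr fun t => ?_
    rw [neg_ofReal_mul_I_cpow h0, neg_one_mul, stableExponent_neg, neg_stableExponent h0.ne',
      ← mul_one α⁻¹, stableExponent_eq_ofReal_mul]
    push_cast
    ring_nf
  simpa [h0.ne'] using (base.exp_neg_stableExponent_of_abs_le h0 (by nlinarith) (by nlinarith)
    hθ).exp_neg_stableExponent_scale h0 (a := l * α) (by positivity)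

/-- Existence of strictly stable laws. -/
theorem isCF_exp_neg_stableExponent (hl : 0 ≤ l) (hα : 0 < α ∧ α ≤ 2)
    (hθ : |θ| ≤ min (Real.pi * α / 2) (Real.pi - Real.pi * α / 2)) :
    IsCF fun t => Complex.exp (-stableExponent l α θ t) := by
  obtain ⟨h0, h2⟩ := hα
  obtain ⟨hθ1, hθ2⟩ := le_min_iff.1 hθ
  have hseq (n : ℕ) : 0 < ((n : ℝ) + 1)⁻¹ ∧ ((n : ℝ) + 1)⁻¹ ≤ 1 :=
    ⟨by positivity, inv_le_one_of_one_le₀ (by linarith [n.cast_nonneg (α := ℝ)])⟩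
  have hlim : Tendsto (fun n : ℕ => 1 - ((n : ℝ) + 1)⁻¹ / 4) atTop (𝓝 1) := by
    simpa using (tendsto_one_div_add_atTop_nhds_zero_nat (𝕜 := ℝ)).div_const 4 |>.const_sub 1
  rcases lt_trichotomy α 1 with h1 | rfl | h1
  · exact isCF_exp_neg_stableExponent_of_lt_one hl h0 h1 hθ1
  · refine IsCF.exp_neg_stableExponent_of_tendsto hl h0 (fun n => ?_) hlim
      (by simpa using hlim.const_mul θ)
    obtain ⟨hn0, hn1⟩ := hseq n
    refine isCF_exp_neg_stableExponent_of_lt_one hl (by linarith) (by linarith) ?_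
    rw [abs_mul, abs_of_pos (by linarith : 0 < 1 - ((n : ℝ) + 1)⁻¹ / 4)]
    rw [mul_one] at hθ1
    rw [mul_div_right_comm]
    gcongr
    linarith
  · rcases h2.eq_or_lt with rfl | h2
    · have hθ0 : θ = 0 := abs_nonpos_iff.1 (by linarith)
      subst hθ0
      refine IsCF.exp_neg_stableExponent_of_tendsto hl h0 (fun n => ?_)
        (by simpa using hlim.const_mul 2) tendsto_const_nhds
      obtain ⟨hn0, hn1⟩ := hseq n
      refine isCF_exp_neg_stableExponent_of_one_lt hl (by linarith) (by linarith) ?_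
      rw [abs_zero]
      nlinarith [Real.pi_pos]
    · exact isCF_exp_neg_stableExponent_of_one_lt hl h1 h2 hθ2

end stableExponent

/-- The `φ`-mixture of a strictly stable law: if `X` is stable with exponent `ψ` and `S ≥ 0` is
independent of `X` with Laplace transform `φ`, then `S ^ (1 / α) * X` has characteristic function
`φ ∘ ψ`. -/
theorem IsLT.isCF_comp {φ : ℂ → ℂ} (hφ : IsLT φ) {ψ : ℝ → ℂ} {α : ℝ} (hα : α ≠ 0)
    (hre : ∀ t, 0 ≤ (ψ t).re) (hmul : ∀ a t : ℝ, 0 ≤ a → ψ (a * t) = ((a ^ α : ℝ) : ℂ) * ψ t)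
    (hψ : IsCF fun t => Complex.exp (-ψ t)) : IsCF fun t => φ (ψ t) := by
  obtain ⟨μ, _, hμ, hφ⟩ := hφ
  obtain ⟨ν, _, hν⟩ := isCF_iff_charFun.1 hψ
  have hmeas : Measurable fun p : ℝ × ℝ => p.1 ^ α⁻¹ * p.2 := by fun_prop
  have : IsProbabilityMeasure ((μ.prod ν).map fun p => p.1 ^ α⁻¹ * p.2) :=
    Measure.isProbabilityMeasure_map hmeas.aemeasurable
  refine (isCF_charFun ((μ.prod ν).map fun p => p.1 ^ α⁻¹ * p.2)).congr fun t => ?_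
  have hint : Integrable (fun p : ℝ × ℝ =>
      Complex.exp (t * (p.1 ^ α⁻¹ * p.2 : ℝ) * Complex.I)) (μ.prod ν) := by
    refine .of_bound (C := 1) (by fun_prop) (.of_forall fun p => ?_)
    rw [← Complex.ofReal_mul, Complex.norm_exp_ofReal_mul_I]
  rw [hφ _ (hre t), charFun_apply_real, integral_map hmeas.aemeasurable (by fun_prop),
    integral_prod _ hint]
  have hnonneg : ∀ᵐ s ∂μ, 0 ≤ s := by
    rw [ae_iff]
    simpa only [not_le, Set.Iio] using! hμ
  refine integral_congr_ae ?_
  filter_upwards [hnonneg] with s hs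
  have hs' : (s ^ α⁻¹) ^ α = s := by rw [← Real.rpow_mul hs, inv_mul_cancel₀ hα, Real.rpow_one]
  have := hν (s ^ α⁻¹ * t)
  rw [hmul _ _ (by positivity), hs', charFun_apply_real] at this
  rw [mul_comm (s : ℂ), ← neg_mul] at this
  rw [this]
  refine integral_congr_ae (.of_forall fun x => ?_)
  push_cast
  ring_nf

/-- A `φ`-mixture of a strictly stable law is in class L (self-decomposable)
whenever `φ` is self-decomposable as a Laplace transform on `[0,∞)`. -/
theorem phi_mixture_of_strictly_stable_selfdecomposable
    (l α θ : ℝ) (hl : 0 < l) (hα : 0 < α ∧ α ≤ 2)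
    (hθ : |θ| ≤ min (Real.pi * α / 2) (Real.pi - Real.pi * α / 2))
    (ψ : ℝ → ℂ)
    (hψ : ∀ t : ℝ, ψ t = ((l * |t| ^ α : ℝ) : ℂ) *
      Complex.exp (-(((θ * Real.sign t : ℝ)) : ℂ) * Complex.I))
    (φ : ℂ → ℂ) (hφ : IsLT φ)
    (hsd : ∀ c : ℝ, 0 < c → c < 1 → ∃ φc : ℂ → ℂ, IsLT φc ∧
      ∀ z : ℂ, 0 ≤ z.re → φ z = φ ((c:ℂ) * z) * φc z) :
    ∀ c : ℝ, 0 < c → c < 1 → ∃ hc : ℝ → ℂ, IsCF hc ∧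
      ∀ t : ℝ, φ (ψ t) = φ (ψ (c * t)) * hc t := by
  intro c hc0 hc1
  obtain ⟨h0, -⟩ := id hα
  obtain rfl : ψ = stableExponent l α θ := funext hψ
  obtain ⟨hθ1, hθ2⟩ := le_min_iff.1 hθ
  have hre : ∀ t, 0 ≤ (stableExponent l α θ t).re :=
    stableExponent_re_nonneg hl.le (by linarith)
  obtain ⟨φc, hφc, h⟩ := hsd (c ^ α) (by positivity) (Real.rpow_lt_one hc0.le hc1 h0)
  refine ⟨fun t => φc (stableExponent l α θ t), ?_, fun t => ?_⟩
  · exact hφc.isCF_comp h0.ne' hre (fun a t ha => stableExponent_mul h0.ne' ha t)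
      (isCF_exp_neg_stableExponent hl.le hα hθ)
  · rw [stableExponent_mul h0.ne' hc0.le]
    exact h _ (hre t)
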